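/- Let k: ℤ → [0,∞) be a nontrivial kernel with k(0)=0, k(−j)=k(j) for all j ∈ ℤ and ∑_{j∈ℤ} k(j) < ∞, satisfying the hypotheses of the moment theorem: α ∈ (1,2], γ = α/(α−1), ∑_{j∈ℕ} k(j) j^α < ∞, k non-increasing on ℕ, and k(j) ≤ C·k(j+1) for all j ∈ ℕ with some C ≥ 1. Let k̃: ℤ → [0,∞) be another kernel with k̃(0)=0, k̃(−j)=k̃(j), and suppose there exist m₁, m₂ > 0 with m₁·k(j) ≤ k̃(j) ≤ m₂·k(j) for all j ∈ ℕ. Then there exists a constant d̃ > 0 such that for every bounded u: ℤ → ℝ and every x ∈ ℤ one has Ψ̃_{2,Υ}(u)(x) ≥ (1/d̃)·|L̃u(x)|^γ, where L̃ and Ψ̃_{2,Υ} are the operators built from the kernel k̃; in particular L̃ satisfies CD_Υ(0, F̃) with the CD-function F̃(r) = (1/d̃)·r^γ. -/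

import Mathlib

open scoped BigOperators
open Filter Set

noncomputable section

/-- `Υ(r) = e^r − 1 − r`. -/
def Ups (r : ℝ) : ℝ := Real.exp r - 1 - r

/-- `H(x) = (1/2) e^{−x} Υ(2x)`. -/
def Hfun (x : ℝ) : ℝ := (1 / 2) * Real.exp (-x) * Ups (2 * x)

/-- The long-range jump operator `L u (x) = ∑_{j∈ℤ} k(j)(u(x+j) − u(x))`. -/
def Lop (k : ℤ → ℝ) (u : ℤ → ℝ) (x : ℤ) : ℝ := ∑' j : ℤ, k j * (u (x + j) - u x)

/-- `Ψ_Υ(u)(x) = ∑_{j∈ℤ} k(j) Υ(u(x+j) − u(x))`. -/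
def PsiUps (k : ℤ → ℝ) (u : ℤ → ℝ) (x : ℤ) : ℝ := ∑' j : ℤ, k j * Ups (u (x + j) - u x)

/-- `Ψ_{2,Υ}(u)(x)`. -/
def Psi2 (k : ℤ → ℝ) (u : ℤ → ℝ) (x : ℤ) : ℝ :=
  (1 / 2) * ∑' p : ℤ × ℤ, k p.1 * k p.2 * Real.exp (u (x + p.2) - u x) *
    Ups (u (x + p.1 + p.2) - u (x + p.1) - u (x + p.2) + u x)

/-- A bounded function on `ℤ`. -/
def BddFun (u : ℤ → ℝ) : Prop := ∃ M : ℝ, ∀ x : ℤ, |u x| ≤ M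

/-- A nontrivial symmetric integrable kernel on `ℤ` vanishing at `0`. -/
structure IsKernel (k : ℤ → ℝ) : Prop where
  nonneg : ∀ j, 0 ≤ k j
  zero_at_zero : k 0 = 0
  symm : ∀ j, k (-j) = k j
  summable : Summable k
  nontrivial : ∃ j, k j ≠ 0

/-- A CD-function: continuous on `[0,∞)`, nonnegative, `F(0)=0`, `r ↦ F(r)/r` strictly
increasing on `(0,∞)` and `1/F` integrable at `∞`. -/
def IsCDFunction (F : ℝ → ℝ) : Prop :=
  ContinuousOn F (Ici 0) ∧ (∀ r, 0 ≤ r → 0 ≤ F r) ∧ F 0 = 0 ∧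
    StrictMonoOn (fun r => F r / r) (Ioi 0) ∧
    ∃ a, 0 < a ∧ MeasureTheory.IntegrableOn (fun r => 1 / F r) (Ici a)

/-- The curvature-dimension condition `CD_Υ(0,F)` for the operator generated by `k`. -/
def CDUps (k : ℤ → ℝ) (F : ℝ → ℝ) : Prop :=
  ∀ u : ℤ → ℝ, BddFun u → ∀ x : ℤ, 0 ≤ -Lop k u x → F (-Lop k u x) ≤ Psi2 k u x


lemma Ups_nonneg (r : ℝ) : 0 ≤ Ups r := by
  unfold Ups; linarith [Real.add_one_le_exp r]

lemma Ups_pos_bound (t : ℝ) (ht : 0 ≤ t) : t ^ 2 / 48 * Real.exp (2 * t / 3) ≤ Ups t := by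
  have h1 : Ups t ≥ (Real.exp (3 * t / 4) - 1) * (t / 4) := by
    have e : Real.exp t = Real.exp (3 * t / 4) * Real.exp (t / 4) := by
      rw [← Real.exp_add]; ring_nf
    have a := Real.add_one_le_exp (t / 4)
    have b := Real.add_one_le_exp (3 * t / 4)
    have c := mul_le_mul_of_nonneg_left a (Real.exp_pos (3 * t / 4)).le
    unfold Ups; rw [e]; nlinarith
  have h2 : Real.exp (3 * t / 4) - 1 ≥ Real.exp (2 * t / 3) * (t / 12) := by
    have e : Real.exp (3 * t / 4) = Real.exp (2 * t / 3) * Real.exp (t / 12) := by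
      rw [← Real.exp_add]; ring_nf
    have a := Real.add_one_le_exp (t / 12)
    have b := Real.one_le_exp (x := 2 * t / 3) (by positivity)
    have c := mul_le_mul_of_nonneg_left a (Real.exp_pos (2 * t / 3)).le
    rw [e]; nlinarith
  have h3 := mul_le_mul_of_nonneg_right h2.le (show 0 ≤ t / 4 by positivity)
  nlinarith

lemma Ups_neg_bound (t : ℝ) (ht : 0 ≤ t) : 7 / 64 * t ^ 2 * Real.exp (-t / 8) ≤ Ups (-t) := by
  have e : Real.exp (-t) = Real.exp (-t / 8) * Real.exp (-(7 * t / 8)) := by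
    rw [← Real.exp_add]; ring_nf
  have a := Real.add_one_le_exp (-(7 * t / 8))
  have c := mul_le_mul_of_nonneg_left a (Real.exp_pos (-t / 8)).le
  have b := Real.add_one_le_exp (-t / 8)
  have b2 : 1 - Real.exp (-t / 8) ≥ t / 8 * Real.exp (-t / 8) := by
    have e2 : Real.exp (-t / 8) * Real.exp (t / 8) = 1 := by
      rw [← Real.exp_add]; ring_nf; simp
    have := mul_le_mul_of_nonneg_left (Real.add_one_le_exp (t / 8)) (Real.exp_pos (-t / 8)).le
    nlinarith
  have h3 := mul_le_mul_of_nonneg_right b2.le (show 0 ≤ 7 * t / 8 by positivity)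
  unfold Ups; rw [e]; nlinarith

lemma rpow_bound (γ ε : ℝ) (hγ : 2 ≤ γ) (hε : 0 < ε) :
    ∃ C : ℝ, 0 < C ∧ ∀ x : ℝ, 0 ≤ x → x ^ γ ≤ C * (x ^ 2 * Real.exp (ε * x)) := by
  set p := γ - 2 with hp
  have hp0 : 0 ≤ p := by linarith
  refine ⟨((p + 1) / ε) ^ p, by positivity, fun x hx => ?_⟩
  have h1 : x ≤ (p + 1) / ε * Real.exp (ε * x / (p + 1)) := by
    have a := Real.add_one_le_exp (ε * x / (p + 1))
    have b : (p + 1) / ε * (ε * x / (p + 1)) = x := by field_simp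
    have c : 0 < (p + 1) / ε := by positivity
    nlinarith
  have h2 : x ^ p ≤ ((p + 1) / ε) ^ p * Real.exp (ε * x) := by
    calc x ^ p ≤ ((p + 1) / ε * Real.exp (ε * x / (p + 1))) ^ p := Real.rpow_le_rpow hx h1 hp0
      _ = ((p + 1) / ε) ^ p * Real.exp (ε * x / (p + 1) * p) := by
        rw [Real.mul_rpow (by positivity) (by positivity), Real.exp_mul]
      _ ≤ _ := by
        refine mul_le_mul_of_nonneg_left (Real.exp_le_exp.2 ?_) (by positivity)
        rw [div_mul_eq_mul_div, div_le_iff₀ (by positivity)]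
        have : 0 ≤ ε * x := by positivity
        nlinarith
  have h3 : x ^ γ = x ^ p * x ^ 2 := by
    rw [← Real.rpow_natCast x 2, ← Real.rpow_add_of_nonneg hx hp0 (by norm_num)]
    congr 1; push_cast; linarith
  rw [h3]
  nlinarith [mul_le_mul_of_nonneg_right h2 (sq_nonneg x)]

lemma H_bound (γ : ℝ) (hγ : 2 ≤ γ) :
    ∃ C : ℝ, 0 < C ∧ ∀ s : ℝ, |s| ^ γ ≤ C * (Real.exp s * Ups (-(2 * s))) := by
  obtain ⟨C, hC, h⟩ := rpow_bound γ (1 / 3) hγ (by norm_num)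
  refine ⟨C * 12, by positivity, fun s => ?_⟩
  refine (h |s| (abs_nonneg s)).trans ?_
  rw [mul_assoc]
  refine mul_le_mul_of_nonneg_left ?_ hC.le
  rcases le_total 0 s with hs | hs
  · rw [abs_of_nonneg hs]
    have a := mul_le_mul_of_nonneg_left (Ups_neg_bound (2 * s) (by positivity)) (Real.exp_pos s).le
    have e : Real.exp s * (7 / 64 * (2 * s) ^ 2 * Real.exp (-(2 * s) / 8))
        = 7 / 16 * s ^ 2 * Real.exp (3 / 4 * s) := by
      have : Real.exp (3 / 4 * s) = Real.exp s * Real.exp (-(2 * s) / 8) := by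
        rw [← Real.exp_add]; ring_nf
      rw [this]; ring
    rw [e] at a
    have m : Real.exp (1 / 3 * s) ≤ Real.exp (3 / 4 * s) := Real.exp_le_exp.2 (by linarith)
    have m2 := mul_le_mul_of_nonneg_left m (sq_nonneg s)
    have m3 : 0 ≤ s ^ 2 * Real.exp (3 / 4 * s) := by positivity
    nlinarith
  · rw [abs_of_nonpos hs]
    have a := mul_le_mul_of_nonneg_left (Ups_pos_bound (-(2 * s)) (by linarith)) (Real.exp_pos s).le
    have e : Real.exp s * ((-(2 * s)) ^ 2 / 48 * Real.exp (2 * (-(2 * s)) / 3))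
        = 1 / 12 * s ^ 2 * Real.exp (1 / 3 * -s) := by
      have : Real.exp (1 / 3 * -s) = Real.exp s * Real.exp (2 * (-(2 * s)) / 3) := by
        rw [← Real.exp_add]; ring_nf
      rw [this]; ring
    rw [e] at a
    nlinarith

lemma pair_aux (s δ y : ℝ) (hs : |s| ≤ y / 16) :
    y ^ 2 * Real.exp (1 / 8 * y) ≤ 128 *
      (Real.exp s * (Real.exp δ * Ups (y - s) + Real.exp (-δ) * Ups (-y - s))) := by
  obtain ⟨s1, s2⟩ := abs_le.1 hs
  have hy : 0 ≤ y := by linarith [abs_nonneg s]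
  have p1 : (y / 16 * Real.exp (5 * y / 16)) ^ 2 ≤ Ups (y - s) := by
    refine le_trans ?_ (Ups_pos_bound (y - s) (by linarith))
    rw [mul_pow, ← Real.exp_nat_mul]
    refine mul_le_mul ?_ (Real.exp_le_exp.2 ?_) (Real.exp_pos _).le (by positivity)
    · nlinarith
    · push_cast; linarith
  have q1 : (y / 16 * Real.exp (-(5 * y / 64))) ^ 2 ≤ Ups (-y - s) := by
    have : -y - s = -(y + s) := by ring
    rw [this]
    refine le_trans ?_ (Ups_neg_bound (y + s) (by linarith))
    rw [mul_pow, ← Real.exp_nat_mul]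
    refine mul_le_mul ?_ (Real.exp_le_exp.2 ?_) (Real.exp_pos _).le (by positivity)
    · nlinarith
    · push_cast; linarith
  set P := y / 16 * Real.exp (5 * y / 16) with hP
  set Q := y / 16 * Real.exp (-(5 * y / 64)) with hQ
  have e1 : Real.exp δ = Real.exp (δ / 2) ^ 2 := by
    rw [← Real.exp_nat_mul]; push_cast; ring_nf
  have e2 : Real.exp (-δ) = Real.exp (-(δ / 2)) ^ 2 := by
    rw [← Real.exp_nat_mul]; push_cast; ring_nf
  have e3 : Real.exp (δ / 2) * Real.exp (-(δ / 2)) = 1 := by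
    rw [← Real.exp_add]; simp
  have h1 : 2 * (P * Q) ≤ Real.exp δ * Ups (y - s) + Real.exp (-δ) * Ups (-y - s) := by
    have a := mul_le_mul_of_nonneg_left p1 (Real.exp_pos δ).le
    have b := mul_le_mul_of_nonneg_left q1 (Real.exp_pos (-δ)).le
    have c := sq_nonneg (Real.exp (δ / 2) * P - Real.exp (-(δ / 2)) * Q)
    have d : (Real.exp (δ / 2) * P - Real.exp (-(δ / 2)) * Q) ^ 2
      = Real.exp δ * P ^ 2 + Real.exp (-δ) * Q ^ 2 - 2 * (P * Q) := by
      rw [e1, e2]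
      linear_combination (-2 * P * Q) * e3
    linarith
  have h2 := mul_le_mul_of_nonneg_left h1 (Real.exp_pos s).le
  have h3 : y ^ 2 * Real.exp (1 / 8 * y) ≤ 128 * (Real.exp s * (2 * (P * Q))) := by
    have : 128 * (Real.exp s * (2 * (P * Q))) = y ^ 2 * Real.exp (s + 5 * y / 16 + -(5 * y / 64)) := by
      rw [Real.exp_add, Real.exp_add, hP, hQ]; ring
    rw [this]
    refine mul_le_mul_of_nonneg_left (Real.exp_le_exp.2 ?_) (sq_nonneg y)
    linarith
  linarith

lemma pair_bound (γ : ℝ) (hγ : 2 ≤ γ) :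
    ∃ C : ℝ, 0 < C ∧ ∀ s δ y : ℝ, |y| ^ γ ≤ C *
      (Real.exp s * (Real.exp δ * Ups (y - s) + Real.exp (-δ) * Ups (-y - s))
        + Real.exp s * Ups (-(2 * s))) := by
  obtain ⟨C1, hC1, h1⟩ := rpow_bound γ (1 / 8) hγ (by norm_num)
  obtain ⟨C2, hC2, h2⟩ := H_bound γ hγ
  refine ⟨C1 * 128 + 16 ^ γ * C2, by positivity, ?_⟩
  have key : ∀ s δ y : ℝ, 0 ≤ y → |y| ^ γ ≤ (C1 * 128 + 16 ^ γ * C2) *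
      (Real.exp s * (Real.exp δ * Ups (y - s) + Real.exp (-δ) * Ups (-y - s))
        + Real.exp s * Ups (-(2 * s))) := by
    intro s δ y hy
    rw [abs_of_nonneg hy]
    have n1 : 0 ≤ Real.exp s * (Real.exp δ * Ups (y - s) + Real.exp (-δ) * Ups (-y - s)) := by
      have := Ups_nonneg (y - s)
      have := Ups_nonneg (-y - s)
      positivity
    have n2 : 0 ≤ Real.exp s * Ups (-(2 * s)) := by
      have := Ups_nonneg (-(2 * s))
      positivity
    set X := Real.exp s * (Real.exp δ * Ups (y - s) + Real.exp (-δ) * Ups (-y - s))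
    set Y := Real.exp s * Ups (-(2 * s))
    have c16 : 0 < (16 : ℝ) ^ γ * C2 := by positivity
    rcases le_total |s| (y / 16) with hs | hs
    · have a := (h1 y hy).trans (mul_le_mul_of_nonneg_left (pair_aux s δ y hs) hC1.le)
      have : 0 ≤ C1 * Y := by positivity
      have : 0 ≤ 16 ^ γ * C2 * (X + Y) := by positivity
      nlinarith
    · have a : y ^ γ ≤ (16 * |s|) ^ γ := Real.rpow_le_rpow hy (by linarith) (by linarith)
      rw [Real.mul_rpow (by norm_num) (abs_nonneg s)] at a
      have b := mul_le_mul_of_nonneg_left (h2 s) (show 0 ≤ (16 : ℝ) ^ γ by positivity)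
      have : 0 ≤ C1 * (X + Y) := by positivity
      have : 0 ≤ 16 ^ γ * C2 * X := by positivity
      nlinarith
  intro s δ y
  rcases le_total 0 y with hy | hy
  · exact key s δ y hy
  · have := key s (-δ) (-y) (by linarith)
    rw [abs_neg, neg_neg, neg_neg] at this
    rwa [add_comm (Real.exp δ * _)]

lemma hardy_step (p : ℝ) (hp : 2 ≤ p) (A B a n : ℝ) (hA : 0 ≤ A) (hB : 0 ≤ B) (ha : 0 ≤ a)
    (hn : 0 ≤ n) (h : (n + 1) * A = n * B + a) :
    (n + 1) * A ^ p + 1 / 2 * A ^ p ≤ n * B ^ p + p * (2 * p) ^ (p - 1) * a ^ p := by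
  have hp1 : 0 < p - 1 := by linarith
  have hsplit : ∀ x : ℝ, 0 ≤ x → x ^ p = x ^ (p - 1) * x := by
    intro x hx
    rw [← Real.rpow_add_one' hx (by linarith)]; ring_nf
  have t : A ^ p + p * A ^ (p - 1) * (B - A) ≤ B ^ p := by
    rcases hA.eq_or_lt with h0 | h0
    · rw [← h0, Real.zero_rpow (by linarith), Real.zero_rpow (by linarith)]
      have := Real.rpow_nonneg hB p
      simpa using this
    · have b := one_add_mul_self_le_rpow_one_add (s := B / A - 1) (p := p)
        (by have : 0 ≤ B / A := by positivity
            linarith) (by linarith)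
      rw [add_sub_cancel, Real.div_rpow hB hA, le_div_iff₀ (by positivity)] at b
      rw [hsplit A hA] at b ⊢
      have e : (1 + p * (B / A - 1)) * (A ^ (p - 1) * A) =
        A ^ (p - 1) * A + p * A ^ (p - 1) * (B - A) := by field_simp
      linarith
  have t2 := mul_le_mul_of_nonneg_left t hn
  have y : p * A ^ (p - 1) * a ≤ 1 / 2 * A ^ p + p * (2 * p) ^ (p - 1) * a ^ p := by
    rcases le_total (2 * p * a) A with hc | hc
    · rw [hsplit A hA]
      have := mul_le_mul_of_nonneg_left hc (Real.rpow_nonneg hA (p - 1))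
      have : 0 ≤ p * (2 * p) ^ (p - 1) * a ^ p := by positivity
      nlinarith
    · have q : A ^ (p - 1) ≤ (2 * p * a) ^ (p - 1) := Real.rpow_le_rpow hA hc hp1.le
      rw [Real.mul_rpow (by linarith) ha] at q
      have q2 := mul_le_mul_of_nonneg_left q (show 0 ≤ p * a by positivity)
      have : 0 ≤ A ^ p := by positivity
      rw [hsplit a ha]
      nlinarith
  have e : n * (p * A ^ (p - 1) * (B - A)) = p * A ^ p - p * A ^ (p - 1) * a := by
    rw [hsplit A hA]
    linear_combination (-(p * A ^ (p - 1))) * h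
  have : 0 ≤ A ^ p := by positivity
  nlinarith

lemma hardy (p : ℝ) (hp : 2 ≤ p) (κ v : ℕ → ℝ) (hκ : ∀ n, 0 ≤ κ n)
    (hmono : ∀ n, κ (n + 1) ≤ κ n) (hv : ∀ n, 0 ≤ v n) (N : ℕ) :
    ∑ n ∈ Finset.range (N + 1), κ n * ((∑ i ∈ Finset.range (n + 1), v i) / (n + 1)) ^ p ≤
      2 * (p * (2 * p) ^ (p - 1)) * ∑ n ∈ Finset.range (N + 1), κ n * v n ^ p := by
  set C := p * (2 * p) ^ (p - 1)
  set V : ℕ → ℝ := fun n => (∑ i ∈ Finset.range (n + 1), v i) / (n + 1) with hV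
  have hV0 : ∀ n, 0 ≤ V n := fun n =>
    div_nonneg (Finset.sum_nonneg fun i _ => hv i) (by positivity)
  have main : ∀ N : ℕ, (N + 1 : ℝ) * κ N * V N ^ p + 1 / 2 * ∑ n ∈ Finset.range (N + 1), κ n * V n ^ p
      ≤ C * ∑ n ∈ Finset.range (N + 1), κ n * v n ^ p := by
    intro N
    induction N with
    | zero =>
      have h := hardy_step p hp (V 0) 0 (v 0) 0 (hV0 0) le_rfl (hv 0) le_rfl (by simp [hV])
      have := mul_le_mul_of_nonneg_left h (hκ 0)
      simp only [zero_add, Finset.range_one, Finset.sum_singleton, Nat.cast_zero]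
      nlinarith
    | succ N ih =>
      have h := hardy_step p hp (V (N + 1)) (V N) (v (N + 1)) (N + 1) (hV0 _) (hV0 _) (hv _)
        (by positivity) (by
          simp only [hV]
          rw [Finset.sum_range_succ _ (N + 1)]
          push_cast
          field_simp)
      have h1 := mul_le_mul_of_nonneg_left h (hκ (N + 1))
      have h2 := mul_le_mul_of_nonneg_right (hmono N)
        (show 0 ≤ (N + 1 : ℝ) * V N ^ p by have := hV0 N; positivity)
      rw [Finset.sum_range_succ _ (N + 1), Finset.sum_range_succ _ (N + 1)]
      push_cast
      nlinarith
  have m := main N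
  have : 0 ≤ (N + 1 : ℝ) * κ N * V N ^ p := by
    have := hV0 N
    have := hκ N
    positivity
  linarith

def TT (kt U : ℤ → ℝ) (p : ℤ × ℤ) : ℝ :=
  kt p.1 * kt p.2 * Real.exp (U p.2) * Ups (U (p.1 + p.2) - U p.1 - U p.2)

lemma TT_nonneg (kt U : ℤ → ℝ) (h : ∀ j, 0 ≤ kt j) (p : ℤ × ℤ) : 0 ≤ TT kt U p := by
  unfold TT
  have := Ups_nonneg (U (p.1 + p.2) - U p.1 - U p.2)
  have := h p.1
  have := h p.2
  positivity

lemma TT_summable (kt U : ℤ → ℝ) (h : ∀ j, 0 ≤ kt j) (hs : Summable kt) (M : ℝ)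
    (hM : ∀ j, |U j| ≤ M) : Summable (TT kt U) := by
  have h2 : Summable fun p : ℤ × ℤ => kt p.1 * kt p.2 :=
    hs.mul_of_nonneg hs h h
  refine Summable.of_nonneg_of_le (TT_nonneg kt U h) (fun p => ?_)
    (h2.mul_right (Real.exp M * (Real.exp (3 * M) + 3 * M)))
  have a1 := abs_le.1 (hM p.1)
  have a2 := abs_le.1 (hM p.2)
  have a3 := abs_le.1 (hM (p.1 + p.2))
  have k0 : 0 ≤ kt p.1 * kt p.2 := mul_nonneg (h _) (h _)
  unfold TT
  rw [mul_assoc]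
  refine mul_le_mul_of_nonneg_left ?_ k0
  refine mul_le_mul (Real.exp_le_exp.2 a2.2) ?_ (Ups_nonneg _) (Real.exp_pos _).le
  unfold Ups
  have : Real.exp (U (p.1 + p.2) - U p.1 - U p.2) ≤ Real.exp (3 * M) :=
    Real.exp_le_exp.2 (by linarith)
  linarith

lemma sum_le_of_inj {ι : Type*} (T : ι → ℝ) (hT : ∀ p, 0 ≤ T p) (hs : Summable T) (f : ℕ → ι)
    (hf : Function.Injective f) (N : ℕ) : ∑ n ∈ Finset.range N, T (f n) ≤ ∑' p, T p := by
  have := hs.sum_le_tsum ((Finset.range N).map ⟨f, hf⟩) (fun p _ => hT p)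
  rwa [Finset.sum_map] at this

lemma dir_bound (γ : ℝ) (C4 : ℝ) (hC4 : 0 < C4)
    (h4 : ∀ s δ y : ℝ, |y| ^ γ ≤ C4 *
      (Real.exp s * (Real.exp δ * Ups (y - s) + Real.exp (-δ) * Ups (-y - s))
        + Real.exp s * Ups (-(2 * s))))
    (κ : ℕ → ℝ) (hκ : ∀ n, 0 ≤ κ n) (hκm : ∀ n, κ (n + 1) ≤ κ n) (hκs : Summable κ)
    (hκ0 : 0 < κ 0) (kt U : ℤ → ℝ) (hkt : ∀ j, 0 ≤ kt j) (hsymm : ∀ j, kt (-j) = kt j)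
    (m₁ : ℝ) (hm₁ : 0 < m₁) (hcomp : ∀ n : ℕ, m₁ * κ n ≤ kt ((n : ℤ) + 1))
    (hU0 : U 0 = 0) (hT : Summable (TT kt U)) (σ : ℤ) (hσ : σ = 1 ∨ σ = -1) (N : ℕ) :
    ∑ n ∈ Finset.range N, κ (n + 1) *
      |U (σ * ((n : ℤ) + 2)) - U (σ * ((n : ℤ) + 1)) - (U σ - U (-σ)) / 2| ^ γ ≤
      (C4 * (2 / (m₁ * (m₁ * κ 0)) + (∑' n, κ n) / (m₁ * κ 0) ^ 2)) * ∑' p, TT kt U p := by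
  set P := ∑' p, TT kt U p with hP
  set c := m₁ * κ 0 with hc
  have hc0 : 0 < c := by positivity
  have hTn := TT_nonneg kt U hkt
  have hktσ : ∀ j : ℤ, kt (σ * j) = kt j := by
    intro j; rcases hσ with h | h <;> subst h
    · rw [one_mul]
    · rw [neg_one_mul, hsymm]
  have hk1 : c ≤ kt 1 := by simpa using hcomp 0
  have hkσ : kt σ = kt 1 := by simpa using hktσ 1
  have hkσ' : kt (-σ) = kt 1 := by rw [hsymm, hkσ]
  have hσ0 : σ ≠ 0 := by rcases hσ with h | h <;> subst h <;> norm_num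
  set A := U σ with hA
  set B := U (-σ) with hB
  set H := Real.exp ((A + B) / 2) * Ups (-(2 * ((A + B) / 2))) with hH
  -- bound on H
  have hHP : c ^ 2 * H ≤ P := by
    have t1 : c ^ 2 * (Real.exp B * Ups (-(2 * ((A + B) / 2)))) ≤ P := by
      refine le_trans ?_ (hT.le_tsum (σ, -σ) (fun p _ => hTn p))
      simp only [TT, hkσ, hkσ', add_neg_cancel, hU0, ← hA, ← hB]
      rw [mul_assoc (kt 1 * kt 1)]
      have e : 0 - A - B = -(2 * ((A + B) / 2)) := by ring
      rw [e]
      have := Ups_nonneg (-(2 * ((A + B) / 2)))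
      refine mul_le_mul_of_nonneg_right ?_ (by positivity)
      nlinarith
    have t2 : c ^ 2 * (Real.exp A * Ups (-(2 * ((A + B) / 2)))) ≤ P := by
      refine le_trans ?_ (hT.le_tsum (-σ, σ) (fun p _ => hTn p))
      simp only [TT, hkσ, hkσ', neg_add_cancel, hU0, ← hA, ← hB]
      rw [mul_assoc (kt 1 * kt 1)]
      have e : 0 - B - A = -(2 * ((A + B) / 2)) := by ring
      rw [e]
      have := Ups_nonneg (-(2 * ((A + B) / 2)))
      refine mul_le_mul_of_nonneg_right ?_ (by positivity)
      nlinarith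
    have e : 2 * Real.exp ((A + B) / 2) ≤ Real.exp A + Real.exp B := by
      have e1 : Real.exp A = Real.exp (A / 2) ^ 2 := by
        rw [← Real.exp_nat_mul]; push_cast; ring_nf
      have e2 : Real.exp B = Real.exp (B / 2) ^ 2 := by
        rw [← Real.exp_nat_mul]; push_cast; ring_nf
      have e3 : Real.exp ((A + B) / 2) = Real.exp (A / 2) * Real.exp (B / 2) := by
        rw [← Real.exp_add]; ring_nf
      rw [e1, e2, e3]
      nlinarith [sq_nonneg (Real.exp (A / 2) - Real.exp (B / 2))]
    have e' := mul_le_mul_of_nonneg_left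
      (mul_le_mul_of_nonneg_right e (Ups_nonneg (-(2 * ((A + B) / 2))))) (sq_nonneg c)
    rw [hH]
    nlinarith
  have hP0 : 0 ≤ P := tsum_nonneg hTn
  have hH0 : 0 ≤ H := mul_nonneg (Real.exp_pos _).le (Ups_nonneg _)
  -- termwise
  have term : ∀ n : ℕ, κ (n + 1) *
      |U (σ * ((n : ℤ) + 2)) - U (σ * ((n : ℤ) + 1)) - (A - B) / 2| ^ γ ≤
      C4 * (1 / (m₁ * c) * TT kt U (σ * ((n : ℤ) + 1), σ)
        + 1 / (m₁ * c) * TT kt U (σ * ((n : ℤ) + 2), -σ) + κ (n + 1) * H) := by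
    intro n
    have h := h4 ((A + B) / 2) ((A - B) / 2)
      (U (σ * ((n : ℤ) + 2)) - U (σ * ((n : ℤ) + 1)) - (A - B) / 2)
    have h' := mul_le_mul_of_nonneg_left h (hκ (n + 1))
    refine h'.trans ?_
    rw [← mul_assoc, mul_comm _ C4, mul_assoc]
    refine mul_le_mul_of_nonneg_left ?_ hC4.le
    rw [mul_add]
    refine add_le_add ?_ le_rfl
    rw [mul_add, mul_add, ← mul_assoc (Real.exp _) (Real.exp _), ← mul_assoc (Real.exp _) (Real.exp _),
      ← Real.exp_add, ← Real.exp_add]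
    have mc : 0 < m₁ * c := by positivity
    have hn2 : m₁ * κ (n + 1) ≤ kt ((n : ℤ) + 2) := by
      have := hcomp (n + 1)
      push_cast at this
      rwa [show (n : ℤ) + 1 + 1 = n + 2 by ring] at this
    have hn1 : m₁ * κ (n + 1) ≤ kt ((n : ℤ) + 1) :=
      (mul_le_mul_of_nonneg_left (hκm n) hm₁.le).trans (hcomp n)
    have hmk : 0 ≤ m₁ * κ (n + 1) := mul_nonneg hm₁.le (hκ _)
    refine add_le_add ?_ ?_
    · rw [one_div, ← div_eq_inv_mul, le_div_iff₀ mc]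
      simp only [TT, hkσ, hktσ, ← hA]
      rw [show σ * ((n : ℤ) + 1) + σ = σ * (n + 2) by ring,
        show (A + B) / 2 + (A - B) / 2 = A by ring,
        show U (σ * ((n : ℤ) + 2)) - U (σ * ((n : ℤ) + 1)) - (A - B) / 2 - (A + B) / 2
          = U (σ * ((n : ℤ) + 2)) - U (σ * ((n : ℤ) + 1)) - A by ring]
      have x := Ups_nonneg (U (σ * ((n : ℤ) + 2)) - U (σ * ((n : ℤ) + 1)) - A)
      have y := mul_le_mul hn1 hk1 hc0.le (hkt _)
      have z := mul_le_mul_of_nonneg_right y (mul_nonneg (Real.exp_pos A).le x)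
      linarith
    · rw [one_div, ← div_eq_inv_mul, le_div_iff₀ mc]
      simp only [TT, hkσ', hktσ, ← hB]
      rw [show σ * ((n : ℤ) + 2) + -σ = σ * (n + 1) by ring,
        show (A + B) / 2 + -((A - B) / 2) = B by ring,
        show -(U (σ * ((n : ℤ) + 2)) - U (σ * ((n : ℤ) + 1)) - (A - B) / 2) - (A + B) / 2
          = U (σ * ((n : ℤ) + 1)) - U (σ * ((n : ℤ) + 2)) - B by ring]
      have x := Ups_nonneg (U (σ * ((n : ℤ) + 1)) - U (σ * ((n : ℤ) + 2)) - B)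
      have y := mul_le_mul hn2 hk1 hc0.le (hkt _)
      have z := mul_le_mul_of_nonneg_right y (mul_nonneg (Real.exp_pos B).le x)
      linarith
  refine (Finset.sum_le_sum fun n _ => term n).trans ?_
  rw [← Finset.mul_sum, mul_assoc]
  refine mul_le_mul_of_nonneg_left ?_ hC4.le
  rw [Finset.sum_add_distrib, Finset.sum_add_distrib, ← Finset.mul_sum, ← Finset.mul_sum,
    ← Finset.sum_mul]
  have i1 := sum_le_of_inj (TT kt U) hTn hT (fun n : ℕ => (σ * ((n : ℤ) + 1), σ))
    (fun a b hab => by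
      simp only [Prod.mk.injEq, and_true] at hab
      have := mul_left_cancel₀ hσ0 hab
      omega) N
  have i2 := sum_le_of_inj (TT kt U) hTn hT (fun n : ℕ => (σ * ((n : ℤ) + 2), -σ))
    (fun a b hab => by
      simp only [Prod.mk.injEq, and_true] at hab
      have := mul_left_cancel₀ hσ0 hab
      omega) N
  have i3 := sum_le_of_inj κ hκ hκs (fun n : ℕ => n + 1) (fun a b hab => by simpa using hab) N
  have mc : 0 ≤ 1 / (m₁ * c) := by positivity
  have j1 := mul_le_mul_of_nonneg_left i1 mc
  have j2 := mul_le_mul_of_nonneg_left i2 mc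
  have j3 := mul_le_mul_of_nonneg_right i3 hH0
  have hK : 0 ≤ ∑' n, κ n := tsum_nonneg hκ
  have j4 : (∑' n, κ n) * H ≤ (∑' n, κ n) / c ^ 2 * P := by
    have : H ≤ P / c ^ 2 := by rw [le_div_iff₀ (by positivity)]; linarith
    calc _ ≤ (∑' n, κ n) * (P / c ^ 2) := mul_le_mul_of_nonneg_left this hK
      _ = _ := by ring
  have e : (2 / (m₁ * c) + (∑' n, κ n) / c ^ 2) * P =
    1 / (m₁ * c) * P + 1 / (m₁ * c) * P + (∑' n, κ n) / c ^ 2 * P := by ring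
  rw [e]
  linarith

lemma H0_bound (kt U : ℤ → ℝ) (hkt : ∀ j, 0 ≤ kt j) (hsymm : ∀ j, kt (-j) = kt j)
    (c : ℝ) (hc0 : 0 < c) (hk1 : c ≤ kt 1) (hU0 : U 0 = 0) (hT : Summable (TT kt U)) :
    c ^ 2 * (Real.exp ((U 1 + U (-1)) / 2) * Ups (-(2 * ((U 1 + U (-1)) / 2)))) ≤
      ∑' p, TT kt U p := by
  have hTn := TT_nonneg kt U hkt
  have hk1' : kt (-1) = kt 1 := hsymm 1
  have hp := Ups_nonneg (-(2 * ((U 1 + U (-1)) / 2)))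
  have cc : c ^ 2 ≤ kt 1 * kt 1 := by nlinarith
  rcases le_total (U 1) (U (-1)) with h | h
  · refine le_trans ?_ (hT.le_tsum (1, -1) (fun p _ => hTn p))
    simp only [TT, hk1', add_neg_cancel, hU0]
    rw [mul_assoc (kt 1 * kt 1), show 0 - U 1 - U (-1) = -(2 * ((U 1 + U (-1)) / 2)) by ring]
    refine mul_le_mul cc (mul_le_mul_of_nonneg_right (Real.exp_le_exp.2 (by linarith)) hp)
      (by positivity) (by nlinarith)
  · refine le_trans ?_ (hT.le_tsum (-1, 1) (fun p _ => hTn p))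
    simp only [TT, hk1', neg_add_cancel, hU0]
    rw [mul_assoc (kt 1 * kt 1), show 0 - U (-1) - U 1 = -(2 * ((U 1 + U (-1)) / 2)) by ring]
    refine mul_le_mul cc (mul_le_mul_of_nonneg_right (Real.exp_le_exp.2 (by linarith)) hp)
      (by positivity) (by nlinarith)

lemma holder_w (α γ : ℝ) (h : α.HolderConjugate γ) (κ f g : ℕ → ℝ) (hκ : ∀ n, 0 ≤ κ n)
    (hf : ∀ n, 0 ≤ f n) (hg : ∀ n, 0 ≤ g n) (N : ℕ) :
    ∑ n ∈ Finset.range N, κ n * (f n * g n) ≤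
      (∑ n ∈ Finset.range N, κ n * f n ^ α) ^ (1 / α) *
      (∑ n ∈ Finset.range N, κ n * g n ^ γ) ^ (1 / γ) := by
  have := Real.inner_le_Lp_mul_Lq_of_nonneg (Finset.range N) h
    (f := fun n => κ n ^ (1 / α) * f n) (g := fun n => κ n ^ (1 / γ) * g n)
    (fun n _ => mul_nonneg (Real.rpow_nonneg (hκ n) _) (hf n))
    (fun n _ => mul_nonneg (Real.rpow_nonneg (hκ n) _) (hg n))
  have ha := h.pos
  have hb := h.symm.pos
  have e1 : ∀ n, κ n ^ (1 / α) * f n * (κ n ^ (1 / γ) * g n) = κ n * (f n * g n) := by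
    intro n
    have : κ n ^ (1 / α) * κ n ^ (1 / γ) = κ n := by
      rw [← Real.rpow_add_of_nonneg (hκ n) (by positivity) (by positivity), one_div, one_div,
        h.inv_add_inv_eq_one, Real.rpow_one]
    linear_combination (f n * g n) * this
  have e2 : ∀ n, (κ n ^ (1 / α) * f n) ^ α = κ n * f n ^ α := by
    intro n
    rw [Real.mul_rpow (Real.rpow_nonneg (hκ n) _) (hf n), ← Real.rpow_mul (hκ n),
      one_div_mul_cancel ha.ne', Real.rpow_one]
  have e3 : ∀ n, (κ n ^ (1 / γ) * g n) ^ γ = κ n * g n ^ γ := by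
    intro n
    rw [Real.mul_rpow (Real.rpow_nonneg (hκ n) _) (hg n), ← Real.rpow_mul (hκ n),
      one_div_mul_cancel hb.ne', Real.rpow_one]
  simp only [e1, e2, e3] at this
  exact this

lemma rpow_abs_add (γ : ℝ) (hγ : 0 ≤ γ) (y z : ℝ) :
    |y + z| ^ γ ≤ 2 ^ γ * (|y| ^ γ + |z| ^ γ) := by
  have hy := Real.rpow_nonneg (abs_nonneg y) γ
  have hz := Real.rpow_nonneg (abs_nonneg z) γ
  have h2 : 0 ≤ (2 : ℝ) ^ γ := by positivity
  rcases le_total |y| |z| with h | h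
  · have : |y + z| ^ γ ≤ (2 * |z|) ^ γ :=
      Real.rpow_le_rpow (abs_nonneg _) (by linarith [abs_add_le y z]) hγ
    rw [Real.mul_rpow (by norm_num) (abs_nonneg z)] at this
    nlinarith [mul_nonneg h2 hy]
  · have : |y + z| ^ γ ≤ (2 * |y|) ^ γ :=
      Real.rpow_le_rpow (abs_nonneg _) (by linarith [abs_add_le y z]) hγ
    rw [Real.mul_rpow (by norm_num) (abs_nonneg y)] at this
    nlinarith [mul_nonneg h2 hz]

set_option maxHeartbeats 2000000 in
/-- Corollary (comparable kernels): if `k` satisfies the hypotheses of the moment theorem and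
`k̃` is a symmetric kernel with `m₁ k(j) ≤ k̃(j) ≤ m₂ k(j)` on `ℕ`, then there is `d̃ > 0` such
that `Ψ̃_{2,Υ}(u)(x) ≥ (1/d̃)|L̃u(x)|^γ` for all bounded `u` and all `x`; in particular `L̃`
satisfies `CD_Υ(0,F̃)` with `F̃(r) = (1/d̃) r^γ`. -/
theorem comparison_CD (k : ℤ → ℝ) (hk : IsKernel k) (α γ : ℝ)
    (hα1 : 1 < α) (hα2 : α ≤ 2) (hγ : γ = α / (α - 1))
    (hmom : Summable fun n : ℕ => k (n : ℤ) * (n : ℝ) ^ α)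
    (hmono : ∀ n : ℕ, 1 ≤ n → k ((n : ℤ) + 1) ≤ k (n : ℤ))
    (C : ℝ) (hC : 1 ≤ C) (hgrow : ∀ n : ℕ, 1 ≤ n → k (n : ℤ) ≤ C * k ((n : ℤ) + 1))
    (kt : ℤ → ℝ) (hktnonneg : ∀ j, 0 ≤ kt j) (hkt0 : kt 0 = 0)
    (hktsymm : ∀ j, kt (-j) = kt j)
    (m₁ m₂ : ℝ) (hm₁ : 0 < m₁) (hm₂ : 0 < m₂)
    (hcomp : ∀ n : ℕ, 1 ≤ n → m₁ * k (n : ℤ) ≤ kt (n : ℤ) ∧ kt (n : ℤ) ≤ m₂ * k (n : ℤ)) :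
    ∃ d : ℝ, 0 < d ∧
      (∀ u : ℤ → ℝ, BddFun u → ∀ x : ℤ,
        (1 / d) * |Lop kt u x| ^ γ ≤ Psi2 kt u x) ∧
      CDUps kt (fun r => (1 / d) * r ^ γ) := by
  have hγ2 : 2 ≤ γ := by
    rw [hγ, le_div_iff₀ (by linarith)]; linarith
  have hconj : α.HolderConjugate γ := by
    rw [hγ]; exact Real.HolderConjugate.conjExponent hα1
  set κ : ℕ → ℝ := fun n => k ((n : ℤ) + 1) with hκdef
  have hκ : ∀ n, 0 ≤ κ n := fun n => hk.nonneg _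
  have hκm : ∀ n, κ (n + 1) ≤ κ n := fun n => by
    have := hmono (n + 1) (by omega)
    push_cast at this
    simpa [hκdef] using this
  have inj1 : Function.Injective (fun n : ℕ => (n : ℤ) + 1) := fun a b h => by
    simpa using h
  have hκs : Summable κ := hk.summable.comp_injective inj1
  have hκ0 : 0 < κ 0 := by
    rcases (hκ 0).eq_or_lt with h0 | h0
    · exfalso
      have hz : ∀ n, κ n = 0 := by
        intro n
        have : κ n ≤ κ 0 := antitone_nat_of_succ_le hκm (Nat.zero_le n)
        exact le_antisymm (this.trans h0.ge) (hκ n)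
      obtain ⟨j, hj⟩ := hk.nontrivial
      apply hj
      rcases lt_trichotomy j 0 with h | h | h
      · have := hz (-j - 1).toNat
        simp only [hκdef] at this
        rw [Int.toNat_of_nonneg (by omega)] at this
        rw [← hk.symm j, ← this]; congr 1; ring
      · rw [h, hk.zero_at_zero]
      · have := hz (j - 1).toNat
        simp only [hκdef] at this
        rw [Int.toNat_of_nonneg (by omega)] at this
        rw [← this]; congr 1; ring
    · exact h0
  have hc1 : ∀ n : ℕ, m₁ * κ n ≤ kt ((n : ℤ) + 1) := fun n => by
    have := (hcomp (n + 1) (by omega)).1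
    push_cast at this
    exact this
  have hc2 : ∀ n : ℕ, kt ((n : ℤ) + 1) ≤ m₂ * κ n := fun n => by
    have := (hcomp (n + 1) (by omega)).2
    push_cast at this
    exact this
  have hkts : Summable kt := by
    refine Summable.of_nonneg_of_le hktnonneg (fun j => ?_) (hk.summable.mul_left m₂)
    rcases lt_trichotomy j 0 with h | h | h
    · have := (hcomp (-j).toNat (by omega)).2
      rw [Int.toNat_of_nonneg (by omega), hktsymm, hk.symm] at this
      exact this
    · rw [h, hkt0, hk.zero_at_zero, mul_zero]
    · have := (hcomp j.toNat (by omega)).2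
      rw [Int.toNat_of_nonneg (by omega)] at this
      exact this
  have hMs : Summable fun n : ℕ => κ n * ((n : ℝ) + 1) ^ α := by
    have := (summable_nat_add_iff 1).2 hmom
    push_cast at this
    exact this
  set M := ∑' n : ℕ, κ n * ((n : ℝ) + 1) ^ α with hM
  have hMt : ∀ n : ℕ, 0 ≤ κ n * ((n : ℝ) + 1) ^ α := fun n =>
    mul_nonneg (hκ n) (by positivity)
  have hM0 : 0 ≤ M := tsum_nonneg hMt
  obtain ⟨C4, hC4, h4⟩ := pair_bound γ hγ2
  obtain ⟨C2, hC2, h2⟩ := H_bound γ hγ2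
  set c := m₁ * κ 0 with hc
  have hc0 : 0 < c := by positivity
  have hK0 : 0 ≤ ∑' n, κ n := tsum_nonneg hκ
  set D1 := C4 * (2 / (m₁ * c) + (∑' n, κ n) / c ^ 2) with hD1
  have hD10 : 0 ≤ D1 := by positivity
  set D2 := 2 ^ γ * (2 * D1) + κ 0 * (2 ^ γ * (C2 / c ^ 2)) with hD2
  have hD20 : 0 ≤ D2 := by positivity
  set CH := 2 * (γ * (2 * γ) ^ (γ - 1)) with hCH
  have hCH0 : 0 ≤ CH := by positivity
  set D := (m₂ * M ^ (1 / α)) ^ γ * (CH * D2) * 2 with hD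
  have hD0 : 0 ≤ D := by positivity
  have main : ∀ u : ℤ → ℝ, BddFun u → ∀ x : ℤ, |Lop kt u x| ^ γ ≤ D * Psi2 kt u x := by
    intro u hu x
    obtain ⟨B, hB⟩ := hu
    set U : ℤ → ℝ := fun j => u (x + j) - u x with hU
    have hU0 : U 0 = 0 := by simp [hU]
    have hUb : ∀ j, |U j| ≤ 2 * B := fun j => by
      have a := abs_le.1 (hB (x + j))
      have b := abs_le.1 (hB x)
      simp only [hU]
      rw [abs_le]; constructor <;> linarith
    have hT : Summable (TT kt U) := TT_summable kt U hktnonneg hkts _ hUb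
    have hPsi : Psi2 kt u x = 1 / 2 * ∑' p, TT kt U p := by
      unfold Psi2
      congr 2
      funext p
      simp only [TT, hU]
      congr 2
      rw [add_assoc x]; ring
    set P := ∑' p, TT kt U p with hP
    have hP0 : 0 ≤ P := tsum_nonneg (TT_nonneg kt U hktnonneg)
    set w : ℕ → ℝ := fun n => U ((n : ℤ) + 1) + U (-((n : ℤ) + 1)) with hw
    set v : ℕ → ℝ := fun n => Nat.casesOn n |w 0| (fun m => |w (m + 1) - w m|) with hv
    have hv0 : v 0 = |w 0| := rfl
    have hvs : ∀ n, v (n + 1) = |w (n + 1) - w n| := fun n => rfl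
    have hvn : ∀ n, 0 ≤ v n := fun n => by
      cases n with
      | zero => rw [hv0]; exact abs_nonneg _
      | succ m => rw [hvs]; exact abs_nonneg _
    have hwv : ∀ n, |w n| ≤ ∑ i ∈ Finset.range (n + 1), v i := fun n => by
      induction n with
      | zero => simp [hv0]
      | succ m ih =>
        rw [Finset.sum_range_succ, hvs]
        have := abs_add_le (w m) (w (m + 1) - w m)
        rw [add_sub_cancel] at this
        linarith
    have d1 := dir_bound γ C4 hC4 h4 κ hκ hκm hκs hκ0 kt U hktnonneg hktsymm m₁ hm₁ hc1 hU0 hT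
      1 (Or.inl rfl)
    have d2 := dir_bound γ C4 hC4 h4 κ hκ hκm hκs hκ0 kt U hktnonneg hktsymm m₁ hm₁ hc1 hU0 hT
      (-1) (Or.inr rfl)
    have hvsum : ∀ N, ∑ n ∈ Finset.range (N + 1), κ n * v n ^ γ ≤ D2 * P := by
      intro N
      rw [Finset.sum_range_succ']
      have s1 : ∑ n ∈ Finset.range N, κ (n + 1) * v (n + 1) ^ γ ≤ 2 ^ γ * (2 * D1) * P := by
        have : ∀ n ∈ Finset.range N, κ (n + 1) * v (n + 1) ^ γ ≤ 2 ^ γ * (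
            κ (n + 1) * |U (1 * ((n : ℤ) + 2)) - U (1 * ((n : ℤ) + 1)) - (U 1 - U (-1)) / 2| ^ γ +
            κ (n + 1) * |U (-1 * ((n : ℤ) + 2)) - U (-1 * ((n : ℤ) + 1))
              - (U (-1) - U (- -1)) / 2| ^ γ) := by
          intro n _
          have r := rpow_abs_add γ (by linarith)
            (U (1 * ((n : ℤ) + 2)) - U (1 * ((n : ℤ) + 1)) - (U 1 - U (-1)) / 2)
            (U (-1 * ((n : ℤ) + 2)) - U (-1 * ((n : ℤ) + 1)) - (U (-1) - U (- -1)) / 2)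
          have e : U (1 * ((n : ℤ) + 2)) - U (1 * ((n : ℤ) + 1)) - (U 1 - U (-1)) / 2 +
            (U (-1 * ((n : ℤ) + 2)) - U (-1 * ((n : ℤ) + 1)) - (U (-1) - U (- -1)) / 2)
            = w (n + 1) - w n := by
            simp only [hw, one_mul, neg_one_mul, neg_neg]
            push_cast
            rw [show (n : ℤ) + 1 + 1 = n + 2 by ring]
            ring
          rw [e, ← hvs] at r
          have := mul_le_mul_of_nonneg_left r (hκ (n + 1))
          linarith
        refine (Finset.sum_le_sum this).trans ?_
        rw [← Finset.mul_sum, Finset.sum_add_distrib, mul_assoc]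
        refine mul_le_mul_of_nonneg_left ?_ (by positivity)
        have a := d1 N
        have b := d2 N
        linarith
      have s2 : κ 0 * v 0 ^ γ ≤ κ 0 * (2 ^ γ * (C2 / c ^ 2)) * P := by
        rw [mul_assoc, mul_assoc]
        refine mul_le_mul_of_nonneg_left ?_ hκ0.le
        have hw0 : w 0 = 2 * ((U 1 + U (-1)) / 2) := by
          simp only [hw]; norm_num; ring
        rw [hv0, hw0, abs_mul, Real.mul_rpow (abs_nonneg _) (abs_nonneg _), abs_two]
        refine mul_le_mul_of_nonneg_left ?_ (by positivity)
        have a := h2 ((U 1 + U (-1)) / 2)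
        have b := H0_bound kt U hktnonneg hktsymm c hc0 (by simpa using hc1 0) hU0 hT
        refine a.trans ?_
        rw [div_mul_eq_mul_div, le_div_iff₀ (by positivity), mul_assoc]
        refine mul_le_mul_of_nonneg_left ?_ hC2.le
        linarith
      rw [hD2, add_mul]
      linarith
    set R := m₂ * (M ^ (1 / α) * (CH * D2 * P) ^ (1 / γ)) with hR
    have hsum : ∀ N, ∑ n ∈ Finset.range N, kt ((n : ℤ) + 1) * |w n| ≤ R := by
      intro N
      have step : ∑ n ∈ Finset.range N, kt ((n : ℤ) + 1) * |w n| ≤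
          ∑ n ∈ Finset.range (N + 1), kt ((n : ℤ) + 1) * |w n| := by
        rw [Finset.sum_range_succ]
        have := mul_nonneg (hktnonneg ((N : ℤ) + 1)) (abs_nonneg (w N))
        linarith
      refine step.trans ?_
      have hX0 : ∀ n : ℕ, 0 ≤ (∑ i ∈ Finset.range (n + 1), v i) / ((n : ℝ) + 1) := fun n =>
        div_nonneg (Finset.sum_nonneg fun i _ => hvn i) (by positivity)
      have t : ∀ n ∈ Finset.range (N + 1), kt ((n : ℤ) + 1) * |w n| ≤
          m₂ * (κ n * (((n : ℝ) + 1) * ((∑ i ∈ Finset.range (n + 1), v i) / ((n : ℝ) + 1)))) := by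
        intro n _
        rw [mul_div_cancel₀ _ (by positivity : (n : ℝ) + 1 ≠ 0), ← mul_assoc]
        exact mul_le_mul (hc2 n) (hwv n) (abs_nonneg _) (mul_nonneg hm₂.le (hκ n))
      refine (Finset.sum_le_sum t).trans ?_
      rw [← Finset.mul_sum]
      refine mul_le_mul_of_nonneg_left ?_ hm₂.le
      refine (holder_w α γ hconj κ _ _ hκ (fun n => by positivity) hX0 (N + 1)).trans ?_
      refine mul_le_mul ?_ ?_ (Real.rpow_nonneg (Finset.sum_nonneg fun n _ =>
        mul_nonneg (hκ n) (Real.rpow_nonneg (hX0 n) _)) _) (by positivity)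
      · exact Real.rpow_le_rpow (Finset.sum_nonneg fun n _ => hMt n)
          (hMs.sum_le_tsum _ fun n _ => hMt n) (by have := hconj.pos; positivity)
      · refine Real.rpow_le_rpow (Finset.sum_nonneg fun n _ =>
          mul_nonneg (hκ n) (Real.rpow_nonneg (hX0 n) _)) ?_ (by positivity)
        refine (hardy γ hγ2 κ v hκ hκm hvn N).trans ?_
        rw [mul_assoc CH]
        exact mul_le_mul_of_nonneg_left (hvsum N) hCH0
    have hLs : Summable fun j : ℤ => kt j * U j := by
      refine Summable.of_norm_bounded (hkts.mul_right (2 * B)) fun j => ?_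
      rw [norm_mul, Real.norm_of_nonneg (hktnonneg j), Real.norm_eq_abs]
      exact mul_le_mul_of_nonneg_left (hUb j) (hktnonneg j)
    have hs1 : Summable fun n : ℕ => kt ((n : ℤ) + 1) * U ((n : ℤ) + 1) :=
      hLs.comp_injective inj1
    have hs2 : Summable fun n : ℕ => kt (-((n : ℤ) + 1)) * U (-((n : ℤ) + 1)) :=
      hLs.comp_injective (neg_injective.comp inj1)
    have hs0 : Summable fun n : ℕ => kt (n : ℤ) * U (n : ℤ) :=
      hLs.comp_injective Nat.cast_injective
    have hL : Lop kt u x = ∑' n : ℕ, kt ((n : ℤ) + 1) * w n := by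
      have e0 : Lop kt u x = ∑' j : ℤ, kt j * U j := rfl
      rw [e0, tsum_of_nat_of_neg_add_one hs0 hs2, hs0.tsum_eq_zero_add]
      push_cast
      rw [hkt0, zero_mul, zero_add, ← hs1.tsum_add hs2]
      refine tsum_congr fun n => ?_
      rw [hktsymm, ← mul_add]
    have hwn : ∀ n : ℕ, 0 ≤ kt ((n : ℤ) + 1) * |w n| := fun n =>
      mul_nonneg (hktnonneg _) (abs_nonneg _)
    have hws : Summable fun n : ℕ => kt ((n : ℤ) + 1) * |w n| :=
      summable_of_sum_range_le hwn hsum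
    have hLR : |Lop kt u x| ≤ R := by
      rw [hL, ← Real.norm_eq_abs]
      have e : ∀ n : ℕ, ‖kt ((n : ℤ) + 1) * w n‖ = kt ((n : ℤ) + 1) * |w n| := fun n => by
        rw [norm_mul, Real.norm_of_nonneg (hktnonneg _), Real.norm_eq_abs]
      refine (norm_tsum_le_tsum_norm (by simpa only [e] using hws)).trans ?_
      simp only [e]
      exact Real.tsum_le_of_sum_range_le hwn hsum
    have := Real.rpow_le_rpow (abs_nonneg _) hLR (by linarith : 0 ≤ γ)
    refine this.trans (le_of_eq ?_)
    rw [hR, ← mul_assoc, Real.mul_rpow (by positivity) (by positivity),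
      ← Real.rpow_mul (by positivity), one_div_mul_cancel (by linarith), Real.rpow_one, hPsi, hD]
    ring
  have hPn : ∀ u : ℤ → ℝ, ∀ x : ℤ, 0 ≤ Psi2 kt u x := by
    intro u x
    unfold Psi2
    refine mul_nonneg (by norm_num) (tsum_nonneg fun p => ?_)
    exact mul_nonneg (mul_nonneg (mul_nonneg (hktnonneg _) (hktnonneg _)) (Real.exp_pos _).le)
      (Ups_nonneg _)
  have fin : ∀ u : ℤ → ℝ, BddFun u → ∀ x : ℤ,
      (1 / (D + 1)) * |Lop kt u x| ^ γ ≤ Psi2 kt u x := by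
    intro u hu x
    rw [one_div, ← div_eq_inv_mul, div_le_iff₀ (by positivity)]
    have := main u hu x
    have := hPn u x
    linarith
  refine ⟨D + 1, by positivity, fin, ?_⟩
  intro u hu x hx
  have := fin u hu x
  rwa [abs_of_nonpos (by linarith)] at this
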